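/- Let f : [0,1]^2 → ℝ be (c,α)-mixed Hölder. Then there exists a constant C > 0 depending only on c and α such that for every m ≥ 1 and every (x,y) ∈ [0,1]^2, |f(x,y) − (Σ_{k=0}^{m} f(x_k, y_{m−k}) − Σ_{k=1}^{m} f(x_{k−1}, y_{m−k}))| ≤ C·m·2^{−αm}, where x_k denotes the center of the dyadic interval of length 2^{−k} containing x, and y_j denotes the center of the dyadic interval of length 2^{−j} containing y. -/

import Mathlib

open MeasureTheory ProbabilityTheory
open scoped RealInnerProductSpace Classical

noncomputable section

/-- The `i`-th dyadic interval at scale `k` (`0`-based); the rightmost interval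
is taken closed so that the scale-`k` dyadic intervals partition `[0,1]`. -/
def dyadicI (k i : ℕ) : Set ℝ :=
  if i + 1 = 2 ^ k then Set.Icc ((i : ℝ) / 2 ^ k) (((i : ℝ) + 1) / 2 ^ k)
  else Set.Ico ((i : ℝ) / 2 ^ k) (((i : ℝ) + 1) / 2 ^ k)

/-- Index of the dyadic interval of length `2^{-k}` containing `x ∈ [0,1]`. -/
def dIdx (k : ℕ) (x : ℝ) : ℕ := min (Int.toNat ⌊x * 2 ^ k⌋) (2 ^ k - 1)

/-- Center of the `i`-th dyadic interval at scale `k`. -/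
def dCen (k i : ℕ) : ℝ := ((i : ℝ) + 1 / 2) / 2 ^ k

/-- Center of the dyadic interval of length `2^{-k}` containing `x`. -/
def dyadicCenter (k : ℕ) (x : ℝ) : ℝ := dCen k (dIdx k x)

/-- `f` is `(c,α)`-mixed Hölder on `[0,1]²`. -/
def MixedHolder (c α : ℝ) (f : ℝ × ℝ → ℝ) : Prop :=
  ∀ x ∈ Set.Icc (0:ℝ) 1, ∀ x' ∈ Set.Icc (0:ℝ) 1, ∀ y ∈ Set.Icc (0:ℝ) 1, ∀ y' ∈ Set.Icc (0:ℝ) 1,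
    |f (x', y) - f (x, y)| ≤ c * |x' - x| ^ α ∧
    |f (x, y') - f (x, y)| ≤ c * |y' - y| ^ α ∧
    |f (x', y') - f (x, y') - f (x', y) + f (x, y)| ≤ c * (|x' - x| * |y' - y|) ^ α

theorem dIdx_add_one_le (k : ℕ) (x : ℝ) : (dIdx k x : ℝ) + 1 ≤ 2 ^ k := by
  have h : dIdx k x ≤ 2 ^ k - 1 := min_le_right _ _
  have h2 : dIdx k x + 1 ≤ 2 ^ k := by
    have := Nat.one_le_two_pow (n := k)
    omega
  exact_mod_cast h2

theorem dyadicCenter_mem_Icc (k : ℕ) (x : ℝ) : dyadicCenter k x ∈ Set.Icc (0 : ℝ) 1 := by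
  have h := dIdx_add_one_le k x
  refine ⟨by unfold dyadicCenter dCen; positivity, ?_⟩
  unfold dyadicCenter dCen
  rw [div_le_one (by positivity)]
  linarith

theorem dIdx_le_mul {x : ℝ} (k : ℕ) (hx : 0 ≤ x) : (dIdx k x : ℝ) ≤ x * 2 ^ k := by
  have h : dIdx k x ≤ ⌊x * 2 ^ k⌋₊ := min_le_left _ _
  exact (Nat.cast_le.mpr h).trans (Nat.floor_le (by positivity))

theorem mul_le_dIdx_add_one {x : ℝ} (k : ℕ) (hx : x ≤ 1) :
    x * 2 ^ k ≤ (dIdx k x : ℝ) + 1 := by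
  have hp := Nat.one_le_two_pow (n := k)
  rcases min_choice ⌊x * 2 ^ k⌋₊ (2 ^ k - 1) with h | h
  · have h2 : dIdx k x = ⌊x * 2 ^ k⌋₊ := h
    rw [h2]
    exact (Nat.lt_floor_add_one _).le
  · have h2 : dIdx k x = 2 ^ k - 1 := h
    rw [h2, Nat.cast_sub hp]
    push_cast
    nlinarith [pow_pos (two_pos : (0 : ℝ) < 2) k]

theorem abs_sub_dyadicCenter_le {x : ℝ} (k : ℕ) (hx : x ∈ Set.Icc (0 : ℝ) 1) :
    |x - dyadicCenter k x| ≤ 1 / 2 / 2 ^ k := by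
  have hp : (0 : ℝ) < 2 ^ k := by positivity
  have h1 := dIdx_le_mul k hx.1
  have h2 := mul_le_dIdx_add_one k hx.2
  have e : x - dyadicCenter k x = (x * 2 ^ k - dIdx k x - 1 / 2) / 2 ^ k := by
    unfold dyadicCenter dCen
    field_simp
    ring
  rw [e, abs_div, abs_of_pos hp]
  gcongr
  rw [abs_le]
  constructor <;> linarith

theorem abs_dyadicCenter_succ_sub_le {x : ℝ} (k : ℕ) (hx : x ∈ Set.Icc (0 : ℝ) 1) :
    |dyadicCenter (k + 1) x - dyadicCenter k x| ≤ 3 / 2 / 2 ^ (k + 1) := by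
  have h1 := abs_sub_dyadicCenter_le k hx
  have h2 := abs_sub_dyadicCenter_le (k + 1) hx
  rw [abs_sub_comm] at h2
  have h3 := abs_sub_le (dyadicCenter (k + 1) x) x (dyadicCenter k x)
  have e : (3 : ℝ) / 2 / 2 ^ (k + 1) = 1 / 2 / 2 ^ (k + 1) + 1 / 2 / 2 ^ k := by
    field_simp
    ring
  linarith

/-- The Smolyak error is a sum of two one-variable differences and of `m` mixed differences. -/
theorem sub_smolyak_sum_eq (f : ℝ × ℝ → ℝ) (u v : ℕ → ℝ) (x y : ℝ) (m : ℕ) :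
    f (x, y) - ((∑ k ∈ Finset.range (m + 1), f (u k, v (m - k))) -
        ∑ k ∈ Finset.Icc 1 m, f (u (k - 1), v (m - k))) =
      (f (x, y) - f (u m, y)) + (f (u 0, y) - f (u 0, v m)) +
        ∑ k ∈ Finset.range m, (f (u (k + 1), y) - f (u k, y) - f (u (k + 1), v (m - (k + 1))) +
          f (u k, v (m - (k + 1)))) := by
  have hI : ∑ k ∈ Finset.Icc 1 m, f (u (k - 1), v (m - k)) =
      ∑ k ∈ Finset.range m, f (u k, v (m - (k + 1))) := by
    rw [← Finset.Ico_add_one_right_eq_Icc, Finset.sum_Ico_eq_sum_range]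
    refine Finset.sum_congr (by simp) fun k _ => ?_
    rw [Nat.add_sub_cancel_left, Nat.add_comm 1 k]
  have hT := Finset.sum_range_sub (fun k => f (u k, y)) m
  rw [hI, Finset.sum_range_succ', Finset.sum_add_distrib, Finset.sum_sub_distrib, hT]
  simp only [Nat.sub_zero]
  ring

/-- **Smolyak's lemma.** If `f : [0,1]² → ℝ` is `(c,α)`-mixed Hölder, then there is a
constant `C > 0` depending only on `c` and `α` such that for every `m ≥ 1` and every
`(x,y) ∈ [0,1]²`,
`|f(x,y) − (∑_{k=0}^m f(x_k, y_{m−k}) − ∑_{k=1}^m f(x_{k−1}, y_{m−k}))| ≤ C·m·2^{−αm}`,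
where `x_k` is the center of the dyadic interval of length `2^{-k}` containing `x` and
`y_j` the center of the dyadic interval of length `2^{-j}` containing `y`. -/
theorem smolyak_approximation (c α : ℝ) (hc : 0 < c) (hα : 0 < α) (hα1 : α ≤ 1) :
    ∃ C > 0, ∀ f : ℝ × ℝ → ℝ, MixedHolder c α f →
      ∀ m : ℕ, 1 ≤ m → ∀ x ∈ Set.Icc (0:ℝ) 1, ∀ y ∈ Set.Icc (0:ℝ) 1,
        |f (x, y) -
            ((∑ k ∈ Finset.range (m + 1), f (dyadicCenter k x, dyadicCenter (m - k) y)) -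
              ∑ k ∈ Finset.Icc 1 m, f (dyadicCenter (k - 1) x, dyadicCenter (m - k) y))| ≤
          C * m * (2 : ℝ) ^ (-(α * (m : ℝ))) := by
  refine ⟨3 * c, by positivity, fun f hf m hm x hx y hy => ?_⟩
  set δ : ℝ := (2 : ℝ) ^ (-(α * (m : ℝ))) with hδ
  have hδ0 : 0 < δ := by positivity
  have rpow_le : ∀ t : ℝ, 0 ≤ t → t ≤ 1 / 2 ^ m → c * t ^ α ≤ c * δ := by
    intro t ht h
    have e : ((1 : ℝ) / 2 ^ m) ^ α = δ := by
      rw [hδ, one_div, ← Real.rpow_natCast, ← Real.rpow_neg two_pos.le,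
        ← Real.rpow_mul two_pos.le]
      ring_nf
    rw [← e]
    gcongr
  have half_le : (1 : ℝ) / 2 / 2 ^ m ≤ 1 / 2 ^ m := by
    gcongr
    norm_num
  rw [sub_smolyak_sum_eq f (fun k => dyadicCenter k x) (fun k => dyadicCenter k y)]
  have hX : |f (x, y) - f (dyadicCenter m x, y)| ≤ c * δ :=
    (hf _ (dyadicCenter_mem_Icc m x) x hx y hy y hy).1.trans
      (rpow_le _ (abs_nonneg _) ((abs_sub_dyadicCenter_le m hx).trans half_le))
  have hY : |f (dyadicCenter 0 x, y) - f (dyadicCenter 0 x, dyadicCenter m y)| ≤ c * δ :=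
    (hf _ (dyadicCenter_mem_Icc 0 x) x hx _ (dyadicCenter_mem_Icc m y) y hy).2.1.trans
      (rpow_le _ (abs_nonneg _) ((abs_sub_dyadicCenter_le m hy).trans half_le))
  have hS : |∑ k ∈ Finset.range m, (f (dyadicCenter (k + 1) x, y) - f (dyadicCenter k x, y) -
      f (dyadicCenter (k + 1) x, dyadicCenter (m - (k + 1)) y) +
        f (dyadicCenter k x, dyadicCenter (m - (k + 1)) y))| ≤ m * (c * δ) := by
    refine (Finset.abs_sum_le_sum_abs _ _).trans ?_
    rw [← nsmul_eq_mul]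
    conv_rhs => rw [← Finset.card_range m]
    refine Finset.sum_le_card_nsmul _ _ _ fun k hk => ?_
    obtain ⟨j, rfl⟩ := Nat.exists_eq_add_of_le (Nat.succ_le_of_lt (Finset.mem_range.mp hk))
    rw [Nat.succ_eq_add_one, Nat.add_sub_cancel_left]
    have h := (hf _ (dyadicCenter_mem_Icc k x) _ (dyadicCenter_mem_Icc (k + 1) x)
      _ (dyadicCenter_mem_Icc j y) y hy).2.2
    refine h.trans (rpow_le _ (by positivity) ?_)
    calc _ ≤ (3 / 2 / 2 ^ (k + 1)) * ((1 : ℝ) / 2 / 2 ^ j) := by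
          gcongr
          exacts [abs_dyadicCenter_succ_sub_le k hx, abs_sub_dyadicCenter_le j hy]
      _ = (3 / 4) / 2 ^ (k + 1 + j) := by
          rw [pow_add]
          ring
      _ ≤ 1 / 2 ^ (k + 1 + j) := by
          gcongr
          norm_num
  have hm' : (1 : ℝ) ≤ m := by exact_mod_cast hm
  refine (abs_add_three _ _ _).trans ((add_le_add_three hX hY hS).trans ?_)
  nlinarith [mul_nonneg (mul_pos hc hδ0).le (sub_nonneg.mpr hm')]

end
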